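/- Let m be a positive integer and let α, β, μ be real numbers with α > 0, β > 0, μ > 0. Let Y_m ~ Gamma(m, μ) and X ~ Gamma(α, β) be independent random variables. Then P(Y_m ≤ X) = 1 − Σ_{k=0}^{m−1} (Γ(k+α)/(Γ(k+1)·Γ(α))) · (μ/(μ+β))^k · (β/(μ+β))^α. (This is the probability that all m queued packets, with i.i.d. Exp(μ) service times, are NOT served before the next Gamma(α, β)-distributed packet interarrival, i.e., the probability of transitioning to an empty queue is its complement.) -/

import Mathlib

open MeasureTheory ProbabilityTheory

/-- The gamma density is integrable. -/
lemma integrable_gammaPDFReal {a r : ℝ} (ha : 0 < a) (hr : 0 < r) :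
    Integrable (gammaPDFReal a r) := by
  refine ⟨(measurable_gammaPDFReal a r).aestronglyMeasurable, ?_⟩
  rw [hasFiniteIntegral_iff_ofReal (ae_of_all _ (gammaPDFReal_nonneg ha hr))]
  exact (lintegral_gammaPDF_eq_one ha hr).trans_lt ENNReal.one_lt_top

/-- The gamma density has total mass one. -/
lemma integral_gammaPDFReal {a r : ℝ} (ha : 0 < a) (hr : 0 < r) :
    ∫ x, gammaPDFReal a r x = 1 := by
  rw [integral_eq_lintegral_of_nonneg_ae (ae_of_all _ (gammaPDFReal_nonneg ha hr))
    (measurable_gammaPDFReal a r).aestronglyMeasurable]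
  change (∫⁻ x, gammaPDF a r x).toReal = 1
  rw [lintegral_gammaPDF_eq_one ha hr, ENNReal.toReal_one]

/-- A truncated Poisson sum is, up to sign, an antiderivative of an Erlang density. -/
lemma hasDerivAt_sum_exp_neg_mul_pow (μ : ℝ) (n : ℕ) (x : ℝ) :
    HasDerivAt (fun y ↦ ∑ k ∈ Finset.range (n + 1),
        Real.exp (-(μ * y)) * (μ * y) ^ k / k.factorial)
      (-(μ ^ (n + 1) / n.factorial * x ^ n * Real.exp (-(μ * x)))) x := by
  have hlin : HasDerivAt (fun y : ℝ ↦ μ * y) μ x := by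
    simpa using (hasDerivAt_id x).const_mul μ
  induction n with
  | zero =>
    convert hlin.neg.exp using 1
    · ext y; simp
    · simp; ring
  | succ n ih =>
    simp_rw [Finset.sum_range_succ _ (n + 1)]
    refine (ih.add ((hlin.neg.exp.mul (hlin.pow (n + 1))).div_const
      ((n + 1).factorial : ℝ))).congr_deriv ?_
    have hn : (n.factorial : ℝ) ≠ 0 := by positivity
    simp only [Nat.factorial_succ, Nat.cast_mul, Nat.cast_add, Nat.cast_one, Pi.neg_apply,
      Pi.pow_apply, Nat.add_sub_cancel]
    field_simp
    ring

/-- The cumulative distribution function of a gamma distribution with integer shape. -/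
lemma gammaMeasure_real_Iic {m : ℕ} (hm : 0 < m) {μ x : ℝ} (hμ : 0 < μ) (hx : 0 ≤ x) :
    (gammaMeasure m μ).real (Set.Iic x) =
      1 - ∑ k ∈ Finset.range m, Real.exp (-(μ * x)) * (μ * x) ^ k / k.factorial := by
  have hm' : (0 : ℝ) < m := by exact_mod_cast hm
  have := isProbabilityMeasure_gammaMeasure hm' hμ
  rw [← cdf_eq_real, cdf_gammaMeasure_eq_integral hm' hμ]
  obtain ⟨n, rfl⟩ : ∃ n, m = n + 1 := ⟨m - 1, by lia⟩
  have hsupp : ∀ y ∈ Set.Iic x \ Set.Icc 0 x, gammaPDFReal ((n + 1 : ℕ) : ℝ) μ y = 0 := by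
    rintro y ⟨hy, hy'⟩
    exact if_neg fun h ↦ hy' ⟨h, hy⟩
  rw [setIntegral_eq_of_subset_of_forall_sdiff_eq_zero measurableSet_Iic
      Set.Icc_subset_Iic_self hsupp, integral_Icc_eq_integral_Ioc,
    ← intervalIntegral.integral_of_le hx]
  have hpdf : Set.EqOn (gammaPDFReal ((n + 1 : ℕ) : ℝ) μ)
      (fun y ↦ μ ^ (n + 1) / n.factorial * y ^ n * Real.exp (-(μ * y))) (Set.uIcc 0 x) := by
    intro y hy
    rw [Set.uIcc_of_le hx] at hy
    simp only [gammaPDFReal, if_pos hy.1, Real.rpow_natCast]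
    push_cast
    rw [Real.Gamma_nat_eq_factorial, add_sub_cancel_right, Real.rpow_natCast]
  rw [intervalIntegral.integral_congr hpdf,
    intervalIntegral.integral_eq_sub_of_hasDerivAt
      (fun y _ ↦ by simpa using (hasDerivAt_sum_exp_neg_mul_pow μ n y).neg)
      (Continuous.intervalIntegrable (by fun_prop) _ _)]
  simp [Finset.sum_range_succ']
  ring

/-- Tilting a gamma density by a Poisson weight gives a multiple of another gamma density. -/
lemma gammaPDFReal_mul_exp_neg_mul_pow {α β μ : ℝ} (hα : 0 < α) (hβ : 0 < β) (hμ : 0 < μ)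
    (k : ℕ) {x : ℝ} (hx : x ≠ 0) :
    gammaPDFReal α β x * (Real.exp (-(μ * x)) * (μ * x) ^ k / k.factorial) =
      Real.Gamma (k + α) / (Real.Gamma (k + 1) * Real.Gamma α) *
        (μ / (μ + β)) ^ k * (β / (μ + β)) ^ α * gammaPDFReal (k + α) (μ + β) x := by
  rcases hx.lt_or_gt with hx | hx
  · simp [gammaPDFReal, hx.not_ge]
  have hs : 0 < μ + β := by positivity
  have h1 : Real.Gamma α ≠ 0 := (Real.Gamma_pos_of_pos hα).ne'
  have h2 : Real.Gamma (k + α) ≠ 0 := (Real.Gamma_pos_of_pos (by positivity)).ne'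
  have h3 : (μ + β) ^ α ≠ 0 := (Real.rpow_pos_of_pos hs α).ne'
  simp only [gammaPDFReal, if_pos hx.le]
  rw [Real.Gamma_nat_eq_factorial, div_pow, mul_pow, Real.div_rpow hβ.le hs.le, Real.rpow_add hs,
    Real.rpow_natCast, add_sub_assoc, Real.rpow_add hx, Real.rpow_natCast,
    show -((μ + β) * x) = -(μ * x) + -(β * x) by ring, Real.exp_add]
  field_simp

/-- The expectation of a function under a gamma distribution, in terms of the density. -/
lemma integral_gammaMeasure {a r : ℝ} (ha : 0 < a) (hr : 0 < r) (g : ℝ → ℝ) :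
    ∫ x, g x ∂(gammaMeasure a r) = ∫ x, gammaPDFReal a r x * g x := by
  have hmeas : Measurable (gammaPDF a r) := (measurable_gammaPDFReal a r).ennreal_ofReal
  rw [gammaMeasure, integral_withDensity_eq_integral_toReal_smul hmeas
    (ae_of_all _ fun _ ↦ ENNReal.ofReal_lt_top)]
  simp [gammaPDF, ENNReal.toReal_ofReal (gammaPDFReal_nonneg ha hr _)]

/-- The probability that `m` queued packets with i.i.d. `Exp(μ)` service times
(so total service `Y_m ~ Gamma(m, μ)`) are not all served before the next
`Gamma(α, β)` interarrival time `X`: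
`P(Y_m ≤ X) = 1 − Σ_{k=0}^{m−1} Γ(k+α)/(Γ(k+1)Γ(α)) · (μ/(μ+β))^k · (β/(μ+β))^α`. -/
theorem not_all_served_prob (m : ℕ) (hm : 0 < m) (α β μ : ℝ)
    (hα : 0 < α) (hβ : 0 < β) (hμ : 0 < μ) :
    (((gammaMeasure (m : ℝ) μ).prod (gammaMeasure α β)) {p : ℝ × ℝ | p.1 ≤ p.2}).toReal =
      1 - ∑ k ∈ Finset.range m,
        (Real.Gamma (k + α) / (Real.Gamma (k + 1) * Real.Gamma α)) *
          (μ / (μ + β)) ^ k * (β / (μ + β)) ^ α := by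
  have hm' : (0 : ℝ) < m := by exact_mod_cast hm
  have := isProbabilityMeasure_gammaMeasure hm' hμ
  have := isProbabilityMeasure_gammaMeasure hα hβ
  have hs : 0 < μ + β := by positivity
  have hcond : (((gammaMeasure (m : ℝ) μ).prod (gammaMeasure α β))
      {p : ℝ × ℝ | p.1 ≤ p.2}).toReal =
      ∫ x, (gammaMeasure m μ).real (Set.Iic x) ∂(gammaMeasure α β) := by
    have hmeas : Measurable fun x ↦ gammaMeasure m μ (Set.Iic x) :=
      Monotone.measurable fun x y hxy ↦ measure_mono (Set.Iic_subset_Iic.2 hxy)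
    rw [Measure.prod_apply_symm (measurableSet_le measurable_fst measurable_snd)]
    exact (integral_toReal hmeas.aemeasurable
      (ae_of_all _ fun _ ↦ measure_lt_top _ _)).symm
  rw [hcond, integral_gammaMeasure hα hβ]
  set c : ℕ → ℝ := fun k ↦ Real.Gamma (k + α) / (Real.Gamma (k + 1) * Real.Gamma α) *
    (μ / (μ + β)) ^ k * (β / (μ + β)) ^ α
  have hdens : ∀ᵐ x, gammaPDFReal α β x * (gammaMeasure m μ).real (Set.Iic x) =
      gammaPDFReal α β x -
        ∑ k ∈ Finset.range m, c k * gammaPDFReal (k + α) (μ + β) x := by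
    filter_upwards [Measure.ae_ne volume 0] with x hx
    simp_rw [c, ← gammaPDFReal_mul_exp_neg_mul_pow hα hβ hμ _ hx, ← Finset.mul_sum]
    rcases hx.lt_or_gt with hx | hx
    · simp [gammaPDFReal, hx.not_ge]
    · rw [gammaMeasure_real_Iic hm hμ hx.le]
      ring
  have hint : ∀ k ∈ Finset.range m,
      Integrable fun x ↦ c k * gammaPDFReal (k + α) (μ + β) x := fun k _ ↦
    (integrable_gammaPDFReal (by positivity) hs).const_mul _
  rw [integral_congr_ae hdens, integral_sub (integrable_gammaPDFReal hα hβ)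
    (integrable_finsetSum _ hint), integral_gammaPDFReal hα hβ, integral_finsetSum _ hint]
  congr 1
  refine Finset.sum_congr rfl fun k _ ↦ ?_
  rw [integral_const_mul, integral_gammaPDFReal (by positivity) hs, mul_one]
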